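/- Let ν be a σ-finite Borel measure on (0,∞) with M₁ = ∫₀^∞ z ν(dz) ∈ (0,1), let ρ be a Borel probability measure on (0,∞), w ∈ [0,1], θ ≥ 0, T > 0, and set φ̄ = θ/(1−M₁). For any two bounded continuous functions φ₁, φ₂ : [0,T] × (0,∞) → ℝ with truncations φ̂ᵢ = max(0, min(φ̄, φᵢ)), the truncated Riccati operator satisfies sup_{(t,r) ∈ [0,T]×(0,∞)} |𝔾(φ̂₁)(t,r) − 𝔾(φ̂₂)(t,r)| ≤ M₁ · sup_{(t,r) ∈ [0,T]×(0,∞)} |φ₁(t,r) − φ₂(t,r)|; in particular, since M₁ < 1, the truncated operator is a strict contraction in the supremum norm. -/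

import Mathlib

open MeasureTheory

/-- The Riccati operator `𝔾` of the aggregation model. -/
noncomputable def riccatiOp (ν ρ : Measure ℝ) (w θ : ℝ)
    (φ : ℝ → ℝ → ℝ) (t r : ℝ) : ℝ :=
  θ * Real.exp (-(r * t)) +
    ∫ s in (0:ℝ)..t, Real.exp (-(r * (t - s))) * r *
      (w * (∫ z in Set.Ioi (0:ℝ), (1 - Real.exp (-(φ s r * z))) ∂ν) +
       (1 - w) * ∫ u in Set.Ioi (0:ℝ),
          (∫ z in Set.Ioi (0:ℝ), (1 - Real.exp (-(φ s u * z))) ∂ν) ∂ρ)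

/-- Truncation `φ̂ = max(0, min(c, φ))` at level `c`. -/
noncomputable def truncate (c : ℝ) (φ : ℝ → ℝ → ℝ) : ℝ → ℝ → ℝ :=
  fun t r => max 0 (min c (φ t r))

/-- The exponent functional `x ↦ ∫ (1 - e^{-xz}) ν(dz)` over `(0,∞)`. -/
noncomputable def laplaceExponent (ν : Measure ℝ) (x : ℝ) : ℝ :=
  ∫ z in Set.Ioi (0:ℝ), (1 - Real.exp (-(x * z))) ∂ν

theorem abs_exp_neg_mul_sub_le {x y z : ℝ} (hx : 0 ≤ x) (hy : 0 ≤ y) (hz : 0 ≤ z) :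
    |(1 - Real.exp (-(x * z))) - (1 - Real.exp (-(y * z)))| ≤ |x - y| * z := by
  wlog h : x ≤ y generalizing x y
  · rw [abs_sub_comm, abs_sub_comm x y]
    exact this hy hx (le_of_not_ge h)
  have h1 : Real.exp (-(y * z)) = Real.exp (-(x * z)) * Real.exp (-((y - x) * z)) := by
    rw [← Real.exp_add]
    ring_nf
  have h2 : 1 - (y - x) * z ≤ Real.exp (-((y - x) * z)) := by
    linarith [Real.add_one_le_exp (-((y - x) * z))]
  have h3 : Real.exp (-((y - x) * z)) ≤ 1 :=
    Real.exp_le_one_iff.2 (by nlinarith [mul_nonneg (sub_nonneg.2 h) hz])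
  have h4 : Real.exp (-(x * z)) ≤ 1 :=
    Real.exp_le_one_iff.2 (by nlinarith [mul_nonneg hx hz])
  have h5 := Real.exp_pos (-(x * z))
  rw [abs_sub_comm x y, abs_of_nonneg (sub_nonneg.2 h), h1, abs_le]
  constructor <;> nlinarith

theorem integrableOn_one_sub_exp_neg_mul {ν : Measure ℝ}
    (hν : IntegrableOn (fun z : ℝ => z) (Set.Ioi 0) ν) {x : ℝ} (hx : 0 ≤ x) :
    IntegrableOn (fun z : ℝ => 1 - Real.exp (-(x * z))) (Set.Ioi 0) ν := by
  refine Integrable.mono' (hν.const_mul x)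
    (by fun_prop : Continuous _).aestronglyMeasurable ?_
  refine (ae_restrict_iff' measurableSet_Ioi).2 (.of_forall fun z hz => ?_)
  simpa [abs_of_nonneg hx] using abs_exp_neg_mul_sub_le hx le_rfl (le_of_lt hz)

theorem abs_laplaceExponent_sub_le {ν : Measure ℝ}
    (hν : IntegrableOn (fun z : ℝ => z) (Set.Ioi 0) ν) {x y : ℝ} (hx : 0 ≤ x) (hy : 0 ≤ y) :
    |laplaceExponent ν x - laplaceExponent ν y| ≤ (∫ z in Set.Ioi (0:ℝ), z ∂ν) * |x - y| := by
  unfold laplaceExponent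
  rw [← integral_sub (integrableOn_one_sub_exp_neg_mul hν hx)
    (integrableOn_one_sub_exp_neg_mul hν hy), mul_comm (∫ z in Set.Ioi (0:ℝ), z ∂ν),
    ← integral_const_mul]
  rw [← Real.norm_eq_abs (∫ z in Set.Ioi (0:ℝ), _ ∂ν)]
  refine norm_integral_le_of_norm_le (hν.const_mul |x - y|) ?_
  exact (ae_restrict_iff' measurableSet_Ioi).2 (.of_forall fun z hz =>
    abs_exp_neg_mul_sub_le hx hy (le_of_lt hz))

theorem continuousOn_laplaceExponent {ν : Measure ℝ}
    (hν : IntegrableOn (fun z : ℝ => z) (Set.Ioi 0) ν) :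
    ContinuousOn (laplaceExponent ν) (Set.Ici 0) := by
  have hM : 0 ≤ ∫ z in Set.Ioi (0:ℝ), z ∂ν :=
    setIntegral_nonneg measurableSet_Ioi fun z hz => le_of_lt hz
  refine (LipschitzOnWith.of_dist_le_mul (K := ⟨_, hM⟩) fun x hx y hy => ?_).continuousOn
  exact abs_laplaceExponent_sub_le hν hx hy

theorem truncate_nonneg (c : ℝ) (φ : ℝ → ℝ → ℝ) (t r : ℝ) : 0 ≤ truncate c φ t r :=
  le_max_left _ _

theorem truncate_le {c : ℝ} (hc : 0 ≤ c) (φ : ℝ → ℝ → ℝ) (t r : ℝ) : truncate c φ t r ≤ c :=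
  max_le hc (min_le_left _ _)

theorem abs_truncate_sub_le (c : ℝ) (φ ψ : ℝ → ℝ → ℝ) (t r : ℝ) :
    |truncate c φ t r - truncate c ψ t r| ≤ |φ t r - ψ t r| := by
  unfold truncate
  refine (abs_max_sub_max_le_max _ _ _ _).trans (max_le (by simp) ?_)
  exact (abs_min_sub_min_le_max _ _ _ _).trans (max_le (by simp) le_rfl)

theorem ContinuousOn.truncate {S : Set (ℝ × ℝ)} {φ : ℝ → ℝ → ℝ} (c : ℝ)
    (hφ : ContinuousOn (fun p : ℝ × ℝ => φ p.1 p.2) S) :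
    ContinuousOn (fun p : ℝ × ℝ => truncate c φ p.1 p.2) S :=
  continuousOn_const.sup (continuousOn_const.inf hφ)

theorem continuousOn_laplaceExponent_truncate {ν : Measure ℝ}
    (hν : IntegrableOn (fun z : ℝ => z) (Set.Ioi 0) ν) {S : Set (ℝ × ℝ)} {φ : ℝ → ℝ → ℝ} (c : ℝ)
    (hφ : ContinuousOn (fun p : ℝ × ℝ => φ p.1 p.2) S) :
    ContinuousOn (fun p : ℝ × ℝ => laplaceExponent ν (truncate c φ p.1 p.2)) S :=
  (continuousOn_laplaceExponent hν).comp (hφ.truncate c) fun p _ => truncate_nonneg c φ p.1 p.2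

theorem abs_laplaceExponent_truncate_le {ν : Measure ℝ}
    (hν : IntegrableOn (fun z : ℝ => z) (Set.Ioi 0) ν) {c : ℝ} (hc : 0 ≤ c)
    (φ : ℝ → ℝ → ℝ) (t r : ℝ) :
    |laplaceExponent ν (truncate c φ t r)| ≤ (∫ z in Set.Ioi (0:ℝ), z ∂ν) * c := by
  have hM : 0 ≤ ∫ z in Set.Ioi (0:ℝ), z ∂ν :=
    setIntegral_nonneg measurableSet_Ioi fun z hz => le_of_lt hz
  have h := abs_laplaceExponent_sub_le hν (truncate_nonneg c φ t r) le_rfl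
  have h0 : laplaceExponent ν 0 = 0 := by simp [laplaceExponent]
  rw [h0, sub_zero, sub_zero, abs_of_nonneg (truncate_nonneg c φ t r)] at h
  exact h.trans (mul_le_mul_of_nonneg_left (truncate_le hc φ t r) hM)

/-- Sections of a function continuous on a strip and bounded there are integrable. -/
theorem integrableOn_section_of_continuousOn {ρ : Measure ℝ} [IsFiniteMeasure ρ] {S U : Set ℝ}
    (hU : MeasurableSet U) {F : ℝ → ℝ → ℝ} {B : ℝ}
    (hF : ContinuousOn (fun p : ℝ × ℝ => F p.1 p.2) (S ×ˢ U)) (hB : ∀ s u, |F s u| ≤ B)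
    {s : ℝ} (hs : s ∈ S) : IntegrableOn (F s) U ρ := by
  have h : ContinuousOn (F s) U :=
    hF.comp (f := fun u => (s, u)) (by fun_prop) fun u hu => ⟨hs, hu⟩
  exact (integrable_const B).mono' (h.aestronglyMeasurable hU) (.of_forall fun u => hB s u)

theorem continuousOn_integral_section {ρ : Measure ℝ} [IsFiniteMeasure ρ] {S U : Set ℝ}
    (hU : MeasurableSet U) {F : ℝ → ℝ → ℝ} {B : ℝ}
    (hF : ContinuousOn (fun p : ℝ × ℝ => F p.1 p.2) (S ×ˢ U)) (hB : ∀ s u, |F s u| ≤ B) :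
    ContinuousOn (fun s => ∫ u in U, F s u ∂ρ) S := by
  refine continuousOn_of_dominated (bound := fun _ => B)
    (fun s hs => (integrableOn_section_of_continuousOn hU hF hB hs).aestronglyMeasurable)
    (fun s _ => .of_forall fun u => hB s u) (integrable_const B) ?_
  refine (ae_restrict_iff' hU).2 (.of_forall fun u hu => ?_)
  exact hF.comp (f := fun s => (s, u)) (by fun_prop) fun s hs => ⟨hs, hu⟩

theorem integral_exp_neg_mul_sub_mul (r t : ℝ) :
    ∫ s in (0:ℝ)..t, Real.exp (-(r * (t - s))) * r = 1 - Real.exp (-(r * t)) := by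
  have h : ∀ s ∈ Set.uIcc 0 t, HasDerivAt (fun s => Real.exp (-(r * (t - s))))
      (Real.exp (-(r * (t - s))) * r) s := fun s _ => by
    have := ((((hasDerivAt_id s).const_sub t).const_mul r).neg).exp
    simpa using this
  rw [intervalIntegral.integral_eq_sub_of_hasDerivAt h
    (Continuous.intervalIntegrable (by fun_prop) _ _)]
  simp

/-- The weighted average of a function at `r` and its `ρ`-integral moves by at most `E` when the
function does. -/
theorem abs_mix_sub_mix_le {ρ : Measure ℝ} [IsProbabilityMeasure ρ] {w E r : ℝ}
    (hw : w ∈ Set.Icc (0:ℝ) 1) (hr : r ∈ Set.Ioi (0:ℝ)) {f g : ℝ → ℝ}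
    (hf : IntegrableOn f (Set.Ioi 0) ρ) (hg : IntegrableOn g (Set.Ioi 0) ρ)
    (h : ∀ u ∈ Set.Ioi (0:ℝ), |f u - g u| ≤ E) :
    |(w * f r + (1 - w) * ∫ u in Set.Ioi (0:ℝ), f u ∂ρ) -
      (w * g r + (1 - w) * ∫ u in Set.Ioi (0:ℝ), g u ∂ρ)| ≤ E := by
  have hE : 0 ≤ E := (abs_nonneg _).trans (h r hr)
  have h1 : |(∫ u in Set.Ioi (0:ℝ), f u ∂ρ) - ∫ u in Set.Ioi (0:ℝ), g u ∂ρ| ≤ E := by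
    rw [← integral_sub hf hg]
    refine (norm_setIntegral_le_of_norm_le_const (f := fun u => f u - g u)
      (measure_lt_top _ _) h).trans ?_
    exact mul_le_of_le_one_right hE measureReal_le_one
  have h2 := abs_le.1 h1
  have h3 := abs_le.1 (h r hr)
  obtain ⟨hw0, hw1⟩ := hw
  have hw1' := sub_nonneg.2 hw1
  rw [abs_le]
  constructor <;> nlinarith

/-- Strict contraction of the truncated Riccati operator in the supremum norm:
`sup |𝔾(φ̂₁) − 𝔾(φ̂₂)| ≤ M₁ · sup |φ₁ − φ₂|` (stated via arbitrary upper bounds `D`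
of `|φ₁ − φ₂|` on `[0,T] × (0,∞)`); since `M₁ < 1` this is a strict contraction. -/
theorem truncated_riccatiOp_contraction
    (ν ρ : Measure ℝ) [SigmaFinite ν] [IsProbabilityMeasure ρ]
    (hν : ν (Set.Iic 0) = 0) (hρ : ρ (Set.Iic 0) = 0)
    (hνInt : IntegrableOn (fun z : ℝ => z) (Set.Ioi 0) ν)
    (M₁ : ℝ) (hM₁ : M₁ = ∫ z in Set.Ioi (0:ℝ), z ∂ν)
    (hM₁pos : 0 < M₁) (hM₁lt : M₁ < 1)
    (w : ℝ) (hw : w ∈ Set.Icc (0:ℝ) 1)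
    (θ : ℝ) (hθ : 0 ≤ θ) (T : ℝ) (hT : 0 < T)
    (φ₁ φ₂ : ℝ → ℝ → ℝ)
    (hφ₁c : ContinuousOn (fun p : ℝ × ℝ => φ₁ p.1 p.2) (Set.Icc 0 T ×ˢ Set.Ioi 0))
    (hφ₂c : ContinuousOn (fun p : ℝ × ℝ => φ₂ p.1 p.2) (Set.Icc 0 T ×ˢ Set.Ioi 0))
    (hφ₁b : ∃ C : ℝ, ∀ t ∈ Set.Icc (0:ℝ) T, ∀ r ∈ Set.Ioi (0:ℝ), |φ₁ t r| ≤ C)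
    (hφ₂b : ∃ C : ℝ, ∀ t ∈ Set.Icc (0:ℝ) T, ∀ r ∈ Set.Ioi (0:ℝ), |φ₂ t r| ≤ C) :
    ∀ D : ℝ,
      (∀ t ∈ Set.Icc (0:ℝ) T, ∀ r ∈ Set.Ioi (0:ℝ), |φ₁ t r - φ₂ t r| ≤ D) →
      ∀ t ∈ Set.Icc (0:ℝ) T, ∀ r ∈ Set.Ioi (0:ℝ),
        |riccatiOp ν ρ w θ (truncate (θ / (1 - M₁)) φ₁) t r -
          riccatiOp ν ρ w θ (truncate (θ / (1 - M₁)) φ₂) t r| ≤ M₁ * D := by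
  intro D hD t ht r hr
  have hr0 : 0 < r := hr
  set c := θ / (1 - M₁) with hc_def
  have hc : 0 ≤ c := div_nonneg hθ (by linarith)
  have hD0 : 0 ≤ D := (abs_nonneg _).trans (hD t ht r hr)
  let H : (ℝ → ℝ → ℝ) → ℝ → ℝ → ℝ := fun φ s u => laplaceExponent ν (truncate c φ s u)
  let A : (ℝ → ℝ → ℝ) → ℝ → ℝ := fun φ s =>
    w * H φ s r + (1 - w) * ∫ u in Set.Ioi (0:ℝ), H φ s u ∂ρ
  have hH : ∀ φ : ℝ → ℝ → ℝ,
      ContinuousOn (fun p : ℝ × ℝ => φ p.1 p.2) (Set.Icc 0 T ×ˢ Set.Ioi 0) →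
      ContinuousOn (fun p : ℝ × ℝ => H φ p.1 p.2) (Set.Icc 0 T ×ˢ Set.Ioi 0) := fun φ hφ =>
    continuousOn_laplaceExponent_truncate hνInt c hφ
  have hHb : ∀ φ s u, |H φ s u| ≤ (∫ z in Set.Ioi (0:ℝ), z ∂ν) * c := fun φ s u =>
    abs_laplaceExponent_truncate_le hνInt hc φ s u
  have hI : ∀ φ : ℝ → ℝ → ℝ,
      ContinuousOn (fun p : ℝ × ℝ => φ p.1 p.2) (Set.Icc 0 T ×ˢ Set.Ioi 0) →
      IntervalIntegrable (fun s => Real.exp (-(r * (t - s))) * r * A φ s) volume 0 t := by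
    intro φ hφ
    have h1 : ContinuousOn (fun s => H φ s r) (Set.Icc 0 T) :=
      (hH φ hφ).comp (f := fun s => (s, r)) (by fun_prop) fun s hs => ⟨hs, hr⟩
    have h2 : ContinuousOn (fun s => ∫ u in Set.Ioi (0:ℝ), H φ s u ∂ρ) (Set.Icc 0 T) :=
      continuousOn_integral_section measurableSet_Ioi (hH φ hφ) (hHb φ)
    have hA : ContinuousOn (A φ) (Set.Icc 0 T) :=
      (continuousOn_const.mul h1).add (continuousOn_const.mul h2)
    refine ContinuousOn.intervalIntegrable_of_Icc ht.1 ?_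
    exact ContinuousOn.mul (by fun_prop) (hA.mono (Set.Icc_subset_Icc_right ht.2))
  have hAD : ∀ s ∈ Set.Ioc 0 t, |A φ₁ s - A φ₂ s| ≤ M₁ * D := by
    intro s hs
    have hsT : s ∈ Set.Icc 0 T := ⟨hs.1.le, hs.2.trans ht.2⟩
    refine abs_mix_sub_mix_le hw hr
      (integrableOn_section_of_continuousOn measurableSet_Ioi (hH φ₁ hφ₁c) (hHb φ₁) hsT)
      (integrableOn_section_of_continuousOn measurableSet_Ioi (hH φ₂ hφ₂c) (hHb φ₂) hsT)
      fun u hu => ?_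
    refine (abs_laplaceExponent_sub_le hνInt (truncate_nonneg c φ₁ s u)
      (truncate_nonneg c φ₂ s u)).trans ?_
    rw [← hM₁]
    exact mul_le_mul_of_nonneg_left
      ((abs_truncate_sub_le c φ₁ φ₂ s u).trans (hD s hsT u hu)) hM₁pos.le
  have hG : ∀ φ, riccatiOp ν ρ w θ (truncate c φ) t r = θ * Real.exp (-(r * t)) +
      ∫ s in (0:ℝ)..t, Real.exp (-(r * (t - s))) * r * A φ s := fun φ => rfl
  rw [hG, hG, add_sub_add_left_eq_sub, ← intervalIntegral.integral_sub (hI φ₁ hφ₁c) (hI φ₂ hφ₂c),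
    ← Real.norm_eq_abs]
  calc
    _ ≤ ∫ s in (0:ℝ)..t, Real.exp (-(r * (t - s))) * r * (M₁ * D) := by
      refine intervalIntegral.norm_integral_le_of_norm_le ht.1 (.of_forall fun s hs => ?_)
        (Continuous.intervalIntegrable (by fun_prop) _ _)
      have hk : 0 ≤ Real.exp (-(r * (t - s))) * r := by positivity
      rw [← mul_sub, Real.norm_eq_abs, abs_mul, abs_of_nonneg hk]
      exact mul_le_mul_of_nonneg_left (hAD s hs) hk
    _ = (1 - Real.exp (-(r * t))) * (M₁ * D) := by
      rw [intervalIntegral.integral_mul_const, integral_exp_neg_mul_sub_mul]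
    _ ≤ M₁ * D :=
      mul_le_of_le_one_left (mul_nonneg hM₁pos.le hD0) (by linarith [Real.exp_pos (-(r * t))])
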